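/- If ρ is irrational and ρ is not of the form u^{1/r} for any rational 0 < u < 1 and integer r ≥ 1, then μ_{ρ,N} is not a spectral measure. -/

import Mathlib

open MeasureTheory Complex Real
open scoped ENNReal

/-- The Fourier transform `μ̂(ξ) = ∫ e^{-2πiξx} dμ(x)`. -/
noncomputable def FT (μ : Measure ℝ) (ξ : ℝ) : ℂ :=
  ∫ x, Complex.exp (-2 * Real.pi * Complex.I * ξ * x) ∂μ

/-- `μ` is the self-similar measure `μ(·) = (1/N) ∑_{j<N} μ(ρ⁻¹(·) − j)`. -/
def IsSelfSimilar (ρ : ℝ) (N : ℕ) (μ : Measure ℝ) : Prop :=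
  μ = (N : ℝ≥0∞)⁻¹ • ∑ j ∈ Finset.range N, μ.map (fun x => ρ * x + (j : ℝ))

/-- Orthonormality of the exponentials `e_λ, λ ∈ Λ`, in `L²(μ)`. -/
def ExpOrthonormal (μ : Measure ℝ) (Λ : Set ℝ) : Prop :=
  ∀ l ∈ Λ, ∀ l' ∈ Λ, FT μ (l - l') = if l = l' then 1 else 0

/-- Totality of the exponentials `e_λ, λ ∈ Λ`, in `L²(μ)`. -/
def ExpTotal (μ : Measure ℝ) (Λ : Set ℝ) : Prop :=
  ∀ f : Lp ℂ 2 μ,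
    (∀ l ∈ Λ, ∫ x, f x *
      (starRingEnd ℂ) (Complex.exp (-2 * Real.pi * Complex.I * l * x)) ∂μ = 0) → f = 0

/-- `μ` is a spectral measure: `L²(μ)` admits an orthonormal basis of
exponentials, i.e. a countable maximal orthonormal family `(e_λ)_{λ∈Λ}`. -/
def IsSpectral (μ : Measure ℝ) : Prop :=
  ∃ Λ : Set ℝ, Λ.Countable ∧ ExpOrthonormal μ Λ ∧ ExpTotal μ Λ

/-- A finitary form of Ramsey's theorem for pairs. -/
theorem exists_finset_pairwise_of_finite_coloring {ι κ : Type*} [Infinite ι] [Finite κ]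
    (P : κ → ι → ι → Prop) (hsymm : ∀ c i j, P c i j → P c j i)
    (hP : ∀ i j, i ≠ j → ∃ c, P c i j) :
    ∃ c, ∀ n : ℕ, ∃ s : Finset ι, s.card = n ∧ (s : Set ι).Pairwise (P c) := by
  classical
  let U : Ultrafilter ι := Filter.hyperfilter ι
  have hne : ∀ i, ∀ᶠ j in (U : Filter ι), j ≠ i := fun i =>
    Filter.hyperfilter_le_cofinite (Set.finite_singleton i).compl_mem_cofinite
  have hi : ∀ i, ∃ c, ∀ᶠ j in (U : Filter ι), P c i j := fun i =>
    Ultrafilter.eventually_exists_iff.1 ((hne i).mono fun j hj => hP i j hj.symm)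
  obtain ⟨c, hc⟩ := Ultrafilter.eventually_exists_iff.1
    (Filter.Eventually.of_forall (f := (U : Filter ι)) hi)
  refine ⟨c, fun n => ?_⟩
  suffices ∃ s : Finset ι, s.card = n ∧ (s : Set ι).Pairwise (P c) ∧
      ∀ i ∈ s, ∀ᶠ j in (U : Filter ι), P c i j from
    let ⟨s, h1, h2, _⟩ := this; ⟨s, h1, h2⟩
  induction n with
  | zero => exact ⟨∅, by simp⟩
  | succ n ih =>
    obtain ⟨s, hs, hpair, hev⟩ := ih
    obtain ⟨j, hj, hjs, hjne⟩ := (hc.and (((Finset.eventually_all s).2 hev).and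
      ((Finset.eventually_all s).2 fun i _ => hne i))).exists
    refine ⟨insert j s, ?_, ?_, ?_⟩
    · rw [Finset.card_insert_of_notMem fun h => hjne j h rfl, hs]
    · rw [Finset.coe_insert]
      exact hpair.insert fun i hi _ => ⟨hsymm c _ _ (hjs i hi), hjs i hi⟩
    · simpa [hj] using hev

theorem isCoprime_of_not_dvd {p : ℕ} (hp : p.Prime) {u : ℤ} (hu : ¬ (p : ℤ) ∣ u) :
    IsCoprime (p : ℤ) u :=
  ((Nat.prime_iff_prime_int.1 hp).coprime_iff_not_dvd).2 hu

theorem finite_quotient_span_algebraMap {R B : Type*} [CommRing R] [CommRing B] [Algebra R B]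
    [Module.Finite R B] (r : R) [Finite (R ⧸ Ideal.span {r})] :
    Finite (B ⧸ Ideal.span {algebraMap R B r}) := by
  have h : Finite (B ⧸ Ideal.span {r} • (⊤ : Submodule R B)) :=
    Submodule.finite_quotient_smul _ Module.Finite.fg_top
  rw [Ideal.smul_top_eq_map, Ideal.map_span, Set.image_singleton] at h
  exact h

/-- `y` and `z` differ by an integer prime to `p` times a power of `x`. -/
def UnitDiff {F : Type*} [Field F] (p : ℕ) (x y z : F) : Prop :=
  ∃ (k : ℕ) (u : ℤ), ¬ (p : ℤ) ∣ u ∧ y - z = u * x ^ k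

theorem UnitDiff.symm {F : Type*} [Field F] {p : ℕ} {x y z : F} (h : UnitDiff p x y z) :
    UnitDiff p x z y := by
  obtain ⟨k, u, hu, h⟩ := h
  exact ⟨k, -u, by rwa [dvd_neg], by push_cast; linear_combination -h⟩

section

variable {F : Type*} [Field F] [CharZero F]

/-- The ring of `p`-integral rational numbers, as a subring of a field of characteristic zero. -/
def pIntegral (F : Type*) [Field F] (p : ℕ) [Fact p.Prime] : Subring F where
  carrier := {z | ∃ a b : ℤ, ¬ (p : ℤ) ∣ b ∧ z * b = a}
  mul_mem' := by
    rintro y z ⟨a, b, hb, h⟩ ⟨c, d, hd, h'⟩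
    refine ⟨a * c, b * d, (Nat.prime_iff_prime_int.1 Fact.out).not_dvd_mul hb hd, ?_⟩
    push_cast
    linear_combination z * d * h + a * h'
  one_mem' := ⟨1, 1, (Nat.prime_iff_prime_int.1 Fact.out).not_dvd_one, by simp⟩
  add_mem' := by
    rintro y z ⟨a, b, hb, h⟩ ⟨c, d, hd, h'⟩
    refine ⟨a * d + c * b, b * d, (Nat.prime_iff_prime_int.1 Fact.out).not_dvd_mul hb hd, ?_⟩
    push_cast
    linear_combination d * h + b * h'
  zero_mem' := ⟨0, 1, (Nat.prime_iff_prime_int.1 Fact.out).not_dvd_one, by simp⟩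
  neg_mem' := by
    rintro y ⟨a, b, hb, h⟩
    exact ⟨-a, b, hb, by push_cast; linear_combination -h⟩

variable {p : ℕ} [Fact p.Prime]

theorem inv_intCast_mem_pIntegral {u : ℤ} (hu : ¬ (p : ℤ) ∣ u) : ((u : F))⁻¹ ∈ pIntegral F p := by
  refine ⟨1, u, hu, ?_⟩
  have : (u : F) ≠ 0 := by
    rintro h
    exact hu (by simp [Int.cast_eq_zero.1 h])
  simp [this]

theorem inv_natCast_notMem_pIntegral : ((p : F))⁻¹ ∉ pIntegral F p := by
  rintro ⟨a, b, hb, h⟩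
  have hp : (p : F) ≠ 0 := Nat.cast_ne_zero.2 (Fact.out : p.Prime).ne_zero
  refine hb ⟨a, ?_⟩
  rw [inv_mul_eq_iff_eq_mul₀ hp] at h
  exact_mod_cast h

theorem valuation_intCast_eq_one {V : ValuationSubring F} (hV : pIntegral F p ≤ V.toSubring)
    {u : ℤ} (hu : ¬ (p : ℤ) ∣ u) : V.valuation u = 1 := by
  have hle : V.valuation u ≤ 1 := (V.valuation_le_one_iff _).2 (intCast_mem V u)
  have hge : V.valuation (u : F)⁻¹ ≤ 1 :=
    (V.valuation_le_one_iff _).2 (hV (inv_intCast_mem_pIntegral hu))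
  have hu0 : (u : F) ≠ 0 := by
    rintro h
    exact hu (by simp [Int.cast_eq_zero.1 h])
  rw [map_inv₀, inv_le_one₀ (zero_lt_iff.2 ((Valuation.ne_zero_iff _).2 hu0))] at hge
  exact le_antisymm hle hge

theorem not_isIntegral_div {u : ℤ} (hu : ¬ (p : ℤ) ∣ u) :
    ¬ IsIntegral (pIntegral F p) ((u : F) / p) := by
  intro h
  have hp : (p : F) ≠ 0 := Nat.cast_ne_zero.2 (Fact.out : p.Prime).ne_zero
  obtain ⟨V, hV, hpV⟩ := Ideal.image_subset_nonunits_valuationSubring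
    (Ideal.span {(p : pIntegral F p)}) (by
      rw [Ne, Ideal.span_singleton_eq_top, isUnit_iff_exists_inv]
      rintro ⟨y, hy⟩
      have : (p : F) * y = 1 := by simpa using congrArg Subtype.val hy
      exact inv_natCast_notMem_pIntegral (F := F) (p := p) (eq_inv_of_mul_eq_one_right this ▸ y.2))
  have hlt : V.valuation (p : F) < 1 := V.mem_nonunits_iff.1
    (hpV ⟨_, Ideal.mem_span_singleton_self _, by simp⟩)
  have hint : IsIntegral V ((u : F) / p) :=
    h.map_of_comp_eq (Subring.inclusion hV) (RingHom.id F) (by ext; rfl)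
  obtain ⟨y, hy⟩ := IsIntegrallyClosed.isIntegral_iff.1 hint
  have hle : V.valuation ((u : F) / p) ≤ 1 := (V.valuation_le_one_iff _).2 (hy ▸ y.2)
  rw [map_div₀, valuation_intCast_eq_one hV hu,
    div_le_one₀ (zero_lt_iff.2 ((Valuation.ne_zero_iff _).2 hp))] at hle
  exact hlt.not_ge hle

theorem finite_quotient_pIntegral :
    Finite (pIntegral F p ⧸ Ideal.span {(p : pIntegral F p)}) := by
  have hp := (Fact.out : p.Prime)
  let I := Ideal.span {(p : pIntegral F p)}
  have hpI : (Ideal.Quotient.mk I (p : pIntegral F p)) = 0 :=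
    Ideal.Quotient.eq_zero_iff_mem.2 (Ideal.mem_span_singleton_self _)
  refine Finite.of_surjective (fun k : Fin p => Ideal.Quotient.mk I (k : ℕ)) fun y => ?_
  obtain ⟨⟨z, a, b, hb, h⟩, rfl⟩ := Ideal.Quotient.mk_surjective y
  obtain ⟨s, t, hst⟩ := isCoprime_of_not_dvd hp hb
  have hp0 : (p : ℤ) ≠ 0 := by exact_mod_cast hp.ne_zero
  obtain ⟨k, hk⟩ := Int.eq_ofNat_of_zero_le (Int.emod_nonneg (a * t) hp0)
  have hkp : k < p := by
    have := Int.emod_lt_of_pos (a * t) (b := p) (by exact_mod_cast hp.pos)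
    omega
  refine ⟨⟨k, hkp⟩, ?_⟩
  set Z : pIntegral F p := ⟨z, a, b, hb, h⟩
  have h1 : Z * b = a := Subtype.ext (by simpa using h)
  have h2 : (s : pIntegral F p) * p + t * b = 1 := by exact_mod_cast hst
  have h3 : ((p : pIntegral F p)) * ((a * t / p : ℤ) : pIntegral F p) + (k : ℕ) = a * t := by
    have := Int.mul_ediv_add_emod (a * t) p
    rw [hk] at this
    exact_mod_cast this
  have h4 : Z = (k : ℕ) + p * (((a * t / p : ℤ) : pIntegral F p) + s * Z) := by
    linear_combination Z * (-h2) + t * h1 - h3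
  change Ideal.Quotient.mk I (k : ℕ) = Ideal.Quotient.mk I Z
  rw [h4, map_add, map_mul, hpI, zero_mul, add_zero]

theorem eq_of_intCast_mul_pow_eq {x : F} (hx : ∀ m : ℕ, 0 < m → ∀ q : ℚ, x ^ m ≠ q)
    {a b : ℤ} (ha : a ≠ 0) {k l : ℕ} (h : (a : F) * x ^ k = b * x ^ l) : k = l := by
  have hx0 : x ≠ 0 := fun h0 => hx 1 one_pos 0 (by simp [h0])
  have hb : b ≠ 0 := by
    rintro rfl
    simp [ha, hx0] at h
  have key : ∀ {a b : ℤ} {k l : ℕ}, b ≠ 0 → (a : F) * x ^ k = b * x ^ l → ¬ k < l := by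
    intro a b k l hb h hkl
    obtain ⟨m, rfl⟩ := Nat.exists_eq_add_of_lt hkl
    have hb' : (b : F) ≠ 0 := Int.cast_ne_zero.2 hb
    refine hx (m + 1) m.succ_pos (a / b) ?_
    push_cast
    rw [eq_div_iff hb']
    refine mul_right_cancel₀ (pow_ne_zero k hx0) ?_
    rw [h]
    ring
  exact le_antisymm (not_lt.1 (key ha h.symm)) (not_lt.1 (key hb h))

theorem exists_card_le_of_isIntegral {x : F} (hx0 : x ≠ 0)
    (hx : IsIntegral (pIntegral F p) x) (hx' : IsIntegral (pIntegral F p) x⁻¹) :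
    ∃ n : ℕ, ∀ s : Finset F, (s : Set F).Pairwise (UnitDiff p x) → s.card ≤ n := by
  classical
  let B := Algebra.adjoin (pIntegral F p) {x}
  have hxB : x ∈ B := Algebra.self_mem_adjoin_singleton _ x
  have : Module.Finite (pIntegral F p) B := Module.Finite.iff_fg.2 hx.fg_adjoin_singleton
  have : Finite (pIntegral F p ⧸ Ideal.span {(p : pIntegral F p)}) := finite_quotient_pIntegral
  have hfin := finite_quotient_span_algebraMap (B := B) (p : pIntegral F p)
  rw [map_natCast] at hfin
  have := Fintype.ofFinite (B ⧸ Ideal.span {(p : B)})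
  refine ⟨Fintype.card (B ⧸ Ideal.span {(p : B)}), fun s hs => ?_⟩
  by_contra! hcard
  obtain ⟨i₀, hi₀⟩ : s.Nonempty := Finset.card_pos.1 (by omega)
  have hmem : ∀ i ∈ s, i - i₀ ∈ B := by
    intro i hi
    by_cases h : i = i₀
    · simp [h]
    · obtain ⟨k, u, -, e⟩ := hs hi hi₀ h
      rw [e]
      exact B.mul_mem (intCast_mem B u) (B.pow_mem hxB k)
  obtain ⟨i, -, j, -, hij, hq⟩ := Finset.exists_ne_map_eq_of_card_lt_of_maps_to
    (s := s.attach) (t := Finset.univ) (by simpa using hcard)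
    (f := fun i => Ideal.Quotient.mk (Ideal.span {(p : B)}) ⟨i - i₀, hmem i i.2⟩)
    (by intro i _; simp)
  obtain ⟨⟨β, hβ⟩, hb⟩ := Ideal.mem_span_singleton'.1 (Ideal.Quotient.eq.1 hq)
  have hb' : β * p = i - j := by
    have := congrArg Subtype.val hb
    simpa using this
  obtain ⟨k, u, hu, e⟩ := hs i.2 j.2 fun h => hij (Subtype.ext h)
  refine not_isIntegral_div (F := F) hu ?_
  have hp : (p : F) ≠ 0 := Nat.cast_ne_zero.2 (Fact.out : p.Prime).ne_zero
  have : (u : F) / p = β * x⁻¹ ^ k := by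
    rw [inv_pow, div_eq_iff hp, mul_right_comm, ← div_eq_mul_inv, eq_div_iff (pow_ne_zero k hx0),
      hb', e]
  rw [this]
  exact (IsIntegral.of_mem_of_fg B hx.fg_adjoin_singleton β hβ).mul (hx'.pow k)

theorem exponent_eq_of_valuation_ne_one {x : F} (hx : ∀ m : ℕ, 0 < m → ∀ q : ℚ, x ^ m ≠ q)
    (V : ValuationSubring F) (hV : pIntegral F p ≤ V.toSubring) (hxV : V.valuation x ≠ 1)
    {y z w : F} {k l m : ℕ} {a b c : ℤ} (ha : ¬ (p : ℤ) ∣ a) (hb : ¬ (p : ℤ) ∣ b)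
    (hc : ¬ (p : ℤ) ∣ c) (h₁ : y - z = a * x ^ k) (h₂ : y - w = b * x ^ l)
    (h₃ : z - w = c * x ^ m) : k = l := by
  have hx0 : x ≠ 0 := fun h0 => hx 1 one_pos 0 (by simp [h0])
  have hne : ∀ u : ℤ, ¬ (p : ℤ) ∣ u → u ≠ 0 := by
    rintro u hu rfl
    exact hu (dvd_zero _)
  have hinj : Function.Injective fun n : ℕ => V.valuation x ^ n :=
    pow_right_injective₀ (zero_lt_iff.2 ((Valuation.ne_zero_iff _).2 hx0)) hxV
  have hval : ∀ {u : ℤ} {n : ℕ}, ¬ (p : ℤ) ∣ u → V.valuation (u * x ^ n) = V.valuation x ^ n := by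
    intro u n hu
    rw [map_mul, valuation_intCast_eq_one hV hu, one_mul, map_pow]
  by_contra hkl
  have hmk : m ≠ k := by
    rintro rfl
    refine hkl (eq_of_intCast_mul_pow_eq hx (hne b hb) (b := a + c) ?_).symm
    push_cast
    linear_combination h₁ + h₃ - h₂
  have hml : m ≠ l := by
    rintro rfl
    refine hkl (eq_of_intCast_mul_pow_eq hx (hne a ha) (b := b - c) ?_)
    push_cast
    linear_combination h₂ - h₃ - h₁
  have hdist : V.valuation (b * x ^ l) ≠ V.valuation (-(a * x ^ k)) := by
    rw [Valuation.map_neg, hval ha, hval hb]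
    exact fun h => hkl (hinj h).symm
  have key := Valuation.map_add_of_distinct_val _ hdist
  have e : (b : F) * x ^ l + -(a * x ^ k) = c * x ^ m := by linear_combination h₁ + h₃ - h₂
  rw [e, Valuation.map_neg, hval ha, hval hb, hval hc] at key
  rcases max_choice (V.valuation x ^ l) (V.valuation x ^ k) with h | h
  · exact hml (hinj (key.trans h))
  · exact hmk (hinj (key.trans h))

theorem card_le_of_valuation_ne_one {x : F} (hx : ∀ m : ℕ, 0 < m → ∀ q : ℚ, x ^ m ≠ q)
    (V : ValuationSubring F) (hV : pIntegral F p ≤ V.toSubring) (hxV : V.valuation x ≠ 1)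
    (s : Finset F) (hs : (s : Set F).Pairwise (UnitDiff p x)) : s.card ≤ p + 1 := by
  classical
  by_contra! hcard
  obtain ⟨i₀, hi₀⟩ : s.Nonempty := Finset.card_pos.1 (by omega)
  have hd : ∀ j : s.erase i₀, UnitDiff p x i₀ j := fun j =>
    hs hi₀ (Finset.mem_of_mem_erase j.2) (Finset.ne_of_mem_erase j.2).symm
  choose k u hu e using hd
  obtain ⟨i, -, j, -, hij, hq⟩ := Finset.exists_ne_map_eq_of_card_lt_of_maps_to
    (s := (s.erase i₀).attach) (t := (Finset.univ : Finset (ZMod p)))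
    (by rw [Finset.card_attach, Finset.card_erase_of_mem hi₀, Finset.card_univ, ZMod.card]; omega)
    (f := fun j => (u j : ZMod p)) (by intro i _; simp)
  obtain ⟨m, c, hc, h⟩ := hs (Finset.mem_of_mem_erase i.2) (Finset.mem_of_mem_erase j.2)
    fun h => hij (Subtype.ext h)
  have hk := exponent_eq_of_valuation_ne_one hx V hV hxV (hu i) (hu j) hc (e i) (e j) h
  have hx0 : x ≠ 0 := fun h0 => hx 1 one_pos 0 (by simp [h0])
  have h' : (c : F) * x ^ m = (u j - u i : ℤ) * x ^ k i := by
    have := e j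
    rw [← hk] at this
    push_cast
    linear_combination this - e i - h
  have hm : m = k i := eq_of_intCast_mul_pow_eq hx (fun h0 => hc (by simp [h0])) h'
  rw [hm] at h'
  have hcu : c = u j - u i := by exact_mod_cast mul_right_cancel₀ (pow_ne_zero _ hx0) h'
  exact hc (hcu ▸ (ZMod.intCast_eq_intCast_iff_dvd_sub _ _ _).1 hq)

theorem exists_card_le_of_pairwise_unitDiff {x : F}
    (hx : ∀ m : ℕ, 0 < m → ∀ q : ℚ, x ^ m ≠ q) :
    ∃ n : ℕ, ∀ s : Finset F, (s : Set F).Pairwise (UnitDiff p x) → s.card ≤ n := by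
  have hx0 : x ≠ 0 := fun h0 => hx 1 one_pos 0 (by simp [h0])
  have hval : ∀ y : F, ¬ IsIntegral (pIntegral F p) y →
      ∃ V : ValuationSubring F, pIntegral F p ≤ V.toSubring ∧ V.valuation y ≠ 1 := by
    intro y hy
    obtain ⟨V, hV, hyV⟩ := Subring.exists_le_valuationSubring_of_isIntegrallyClosedIn
      (R := (integralClosure (pIntegral F p) F).toSubring) (x := y) hy
    refine ⟨V, fun z hz => hV ?_, fun h => hyV ((V.valuation_le_one_iff y).1 h.le)⟩
    exact isIntegral_algebraMap (R := pIntegral F p) (A := F) (x := ⟨z, hz⟩)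
  by_cases h₁ : IsIntegral (pIntegral F p) x
  · by_cases h₂ : IsIntegral (pIntegral F p) x⁻¹
    · exact exists_card_le_of_isIntegral hx0 h₁ h₂
    · obtain ⟨V, hV, h⟩ := hval _ h₂
      exact ⟨p + 1, card_le_of_valuation_ne_one hx V hV (by simpa using h)⟩
  · obtain ⟨V, hV, h⟩ := hval _ h₁
    exact ⟨p + 1, card_le_of_valuation_ne_one hx V hV h⟩

/-- If no positive power of `x` is rational, then an infinite set cannot have all its differences
of the form `a * x ^ k` with `a` an integer not divisible by `N`. -/
theorem finite_of_pairwise_sub_eq_mul_pow {x : F} (hx : ∀ m : ℕ, 0 < m → ∀ q : ℚ, x ^ m ≠ q)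
    {N : ℕ} (hN : N ≠ 0) {S : Set F}
    (hS : S.Pairwise fun y z => ∃ (k : ℕ) (a : ℤ), ¬ (N : ℤ) ∣ a ∧ y - z = a * x ^ k) :
    S.Finite := by
  classical
  by_contra hinf
  have : Infinite S := Set.infinite_coe_iff.2 hinf
  let P : Fin (N + 1) × Fin (N + 1) → S → S → Prop := fun c y z =>
    (c.1 : ℕ).Prime ∧ UnitDiff c.1 x (y / (c.1 : F) ^ (c.2 : ℕ)) (z / (c.1 : F) ^ (c.2 : ℕ))
  obtain ⟨⟨p, f⟩, hc⟩ := exists_finset_pairwise_of_finite_coloring P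
    (fun c y z h => ⟨h.1, h.2.symm⟩) (by
      intro y z hyz
      obtain ⟨k, a, ha, e⟩ := hS y.2 z.2 fun h => hyz (Subtype.ext h)
      have ha0 : a ≠ 0 := fun h => ha (h ▸ dvd_zero _)
      have hnd : ¬ N ∣ a.natAbs := fun h => ha (Int.natCast_dvd.2 h)
      obtain ⟨p, n, hp, hpN, hpa⟩ : ∃ p n : ℕ, p.Prime ∧ p ^ n ∣ N ∧ ¬ p ^ n ∣ a.natAbs := by
        by_contra! h
        exact hnd ((Nat.dvd_iff_prime_pow_dvd_dvd _ _).2 fun p n hp => h p n hp)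
      obtain ⟨u, hau, hu⟩ := (FiniteMultiplicity.exists_eq_pow_mul_and_not_dvd
        (Int.finiteMultiplicity_iff.2 ⟨by simpa using hp.ne_one, ha0⟩ :
          FiniteMultiplicity (p : ℤ) a))
      set f := multiplicity (p : ℤ) a
      have hfn : f < n := by
        by_contra! hle
        refine hpa (Int.natCast_dvd.1 ?_)
        push_cast
        rw [hau]
        exact (pow_dvd_pow _ hle).mul_right _
      have hnN : p ^ n ≤ N := Nat.le_of_dvd (Nat.pos_of_ne_zero hN) hpN
      have h1 : n < p ^ n := Nat.lt_pow_self hp.one_lt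
      have h2 : p ≤ p ^ n := Nat.le_self_pow (by omega) p
      refine ⟨(⟨p, by omega⟩, ⟨f, by omega⟩), hp, k, u, hu, ?_⟩
      have hp0 : (p : F) ≠ 0 := Nat.cast_ne_zero.2 hp.ne_zero
      have hau' : (a : F) = p ^ f * u := by exact_mod_cast hau
      dsimp only
      rw [← sub_div, e, hau', mul_assoc, mul_div_cancel_left₀ _ (pow_ne_zero f hp0)])
  obtain ⟨s, hs, hsP⟩ := hc 2
  obtain ⟨y, hy, z, hz, hyz⟩ := Finset.one_lt_card.1 (by omega : 1 < s.card)
  have hp : (p : ℕ).Prime := (hsP hy hz hyz).1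
  have hp0 : ((p : ℕ) : F) ≠ 0 := Nat.cast_ne_zero.2 hp.ne_zero
  have : Fact (p : ℕ).Prime := ⟨hp⟩
  obtain ⟨n, hn⟩ := exists_card_le_of_pairwise_unitDiff (p := p) hx
  obtain ⟨t, ht, htP⟩ := hc (n + 1)
  have hinj : Function.Injective fun y : S => (y : F) / ((p : ℕ) : F) ^ (f : ℕ) := fun y z h =>
    Subtype.ext ((div_left_inj' (pow_ne_zero _ hp0)).1 h)
  have := hn (t.map ⟨_, hinj⟩) (by
    rw [Finset.coe_map]
    rintro _ ⟨y, hy, rfl⟩ _ ⟨z, hz, rfl⟩ h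
    exact (htP hy hz fun e => h (by rw [e])).2)
  rw [Finset.card_map] at this
  omega

end

theorem integrable_exp_mul (μ : Measure ℝ) [IsFiniteMeasure μ] (ξ : ℝ) :
    Integrable (fun x : ℝ => Complex.exp (-2 * Real.pi * Complex.I * ξ * x)) μ := by
  refine Integrable.of_bound (by fun_prop) 1 (Filter.Eventually.of_forall fun x => ?_)
  rw [Complex.norm_exp]
  simp

theorem FT_zero (μ : Measure ℝ) [IsProbabilityMeasure μ] : FT μ 0 = 1 := by
  simp [FT]

theorem continuous_FT (μ : Measure ℝ) [IsFiniteMeasure μ] : Continuous (FT μ) := by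
  refine continuous_of_dominated (bound := fun _ => 1) (fun ξ => ?_) (fun ξ => ?_)
    (integrable_const _) ?_
  · exact (integrable_exp_mul μ ξ).aestronglyMeasurable
  · refine Filter.Eventually.of_forall fun x => ?_
    rw [Complex.norm_exp]
    simp
  · exact Filter.Eventually.of_forall fun x => by fun_prop

theorem FT_eq_of_isSelfSimilar {ρ : ℝ} {N : ℕ} {μ : Measure ℝ} [IsFiniteMeasure μ]
    (hμ : IsSelfSimilar ρ N μ) (ξ : ℝ) :
    FT μ ξ = (N : ℂ)⁻¹ *
      (∑ j ∈ Finset.range N, Complex.exp (-2 * Real.pi * Complex.I * ξ) ^ j) * FT μ (ρ * ξ) := by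
  have hj : ∀ j : ℕ, FT (μ.map fun x => ρ * x + (j : ℝ)) ξ =
      Complex.exp (-2 * Real.pi * Complex.I * ξ) ^ j * FT μ (ρ * ξ) := by
    intro j
    rw [FT, integral_map (by fun_prop) (by fun_prop), FT, ← integral_const_mul]
    refine integral_congr_ae (Filter.Eventually.of_forall fun x => ?_)
    dsimp only
    rw [← Complex.exp_nat_mul, ← Complex.exp_add]
    congr 1
    push_cast
    ring
  calc FT μ ξ = FT ((N : ℝ≥0∞)⁻¹ • ∑ j ∈ Finset.range N, μ.map (fun x => ρ * x + (j : ℝ))) ξ :=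
        congrArg (FT · ξ) hμ
    _ = (N : ℂ)⁻¹ * ∑ j ∈ Finset.range N, FT (μ.map fun x => ρ * x + (j : ℝ)) ξ := by
        rw [FT, integral_smul_measure, integral_finsetSum_measure]
        · simp [FT]
        · exact fun j _ => integrable_exp_mul _ ξ
    _ = _ := by
        simp_rw [hj]
        rw [← Finset.sum_mul, ← mul_assoc]

theorem exists_int_of_geom_sum_exp_eq_zero {N : ℕ} (hN : 0 < N) {ξ : ℝ}
    (h : ∑ j ∈ Finset.range N, Complex.exp (-2 * Real.pi * Complex.I * ξ) ^ j = 0) :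
    ∃ a : ℤ, ¬ (N : ℤ) ∣ a ∧ N * ξ = a := by
  set z := Complex.exp (-2 * Real.pi * Complex.I * ξ) with hz
  have hzN : z ^ N = 1 := by
    have := geom_sum_mul z N
    rw [h, zero_mul] at this
    exact (sub_eq_zero.1 this.symm)
  have hN0 : (N : ℝ) ≠ 0 := by positivity
  rw [hz, ← Complex.exp_nat_mul, Complex.exp_eq_one_iff] at hzN
  obtain ⟨n, hn⟩ := hzN
  have h2 : ((N * ξ : ℝ) : ℂ) = ((-n : ℤ) : ℝ) := by
    have := Complex.two_pi_I_ne_zero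
    push_cast
    refine mul_right_cancel₀ this ?_
    linear_combination -hn
  refine ⟨-n, ?_, by exact_mod_cast h2⟩
  rintro ⟨m, hm⟩
  have h3 : (N : ℝ) * ξ = N * m := by
    rw [Complex.ofReal_inj.1 h2, hm]
    push_cast
    ring
  have hz1 : z = 1 := by
    rw [hz, Complex.exp_eq_one_iff]
    refine ⟨-m, ?_⟩
    rw [mul_left_cancel₀ hN0 h3]
    push_cast
    ring
  rw [hz1] at h
  simp [hN.ne'] at h

/-- The zeros of the Fourier transform of a self-similar measure. -/
theorem exists_of_FT_eq_zero {ρ : ℝ} (hρ : 0 < ρ ∧ ρ < 1) {N : ℕ} (hN : 0 < N) {μ : Measure ℝ}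
    [IsProbabilityMeasure μ] (hμ : IsSelfSimilar ρ N μ) {ξ : ℝ} (hξ : FT μ ξ = 0) :
    ∃ (k : ℕ) (a : ℤ), ¬ (N : ℤ) ∣ a ∧ N * ξ = a * ρ⁻¹ ^ k := by
  obtain ⟨k, hk⟩ : ∃ k : ℕ, ∑ j ∈ Finset.range N,
      Complex.exp (-2 * Real.pi * Complex.I * (ρ ^ k * ξ : ℝ)) ^ j = 0 := by
    by_contra! hne
    have hzero : ∀ k : ℕ, FT μ (ρ ^ k * ξ) = 0 := by
      intro k
      induction k with
      | zero => simpa using hξ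
      | succ k ih =>
        rw [FT_eq_of_isSelfSimilar hμ, mul_eq_zero, mul_eq_zero] at ih
        rcases ih with (ih | ih) | ih
        · simp [hN.ne'] at ih
        · exact absurd ih (hne k)
        · rwa [pow_succ', mul_assoc]
    have hlim : Filter.Tendsto (fun k : ℕ => FT μ (ρ ^ k * ξ)) Filter.atTop (nhds 1) := by
      rw [← FT_zero μ, ← zero_mul ξ]
      exact ((continuous_FT μ).tendsto _).comp
        ((tendsto_pow_atTop_nhds_zero_of_lt_one hρ.1.le hρ.2).mul_const ξ)
    simp_rw [hzero] at hlim
    exact zero_ne_one (tendsto_nhds_unique tendsto_const_nhds hlim)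
  obtain ⟨a, ha, e⟩ := exists_int_of_geom_sum_exp_eq_zero hN hk
  refine ⟨k, a, ha, ?_⟩
  have := (pow_pos hρ.1 k).ne'
  rw [← e, inv_pow]
  field_simp

theorem mul_add_mem_support {ρ : ℝ} {N : ℕ} {μ : Measure ℝ} (hμ : IsSelfSimilar ρ N μ) {x : ℝ}
    (hx : x ∈ μ.support) {j : ℕ} (hj : j < N) : ρ * x + j ∈ μ.support := by
  rw [Measure.mem_support_iff_forall] at hx ⊢
  intro U hU
  have hpre : 0 < μ ((fun x => ρ * x + (j : ℝ)) ⁻¹' U) :=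
    hx _ ((by fun_prop : Continuous fun x : ℝ => ρ * x + (j : ℝ)).continuousAt hU)
  rw [hμ, Measure.smul_apply, Measure.finsetSum_apply, smul_eq_mul]
  refine ENNReal.mul_pos (ENNReal.inv_ne_zero.2 (ENNReal.natCast_ne_top N)) (ne_of_gt ?_)
  calc 0 < μ ((fun x => ρ * x + (j : ℝ)) ⁻¹' U) := hpre
    _ ≤ μ.map (fun x => ρ * x + (j : ℝ)) U := Measure.le_map_apply (by fun_prop) U
    _ ≤ _ := Finset.single_le_sum (f := fun j : ℕ => μ.map (fun x => ρ * x + (j : ℝ)) U)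
        (fun _ _ => zero_le) (Finset.mem_range.2 hj)

theorem infinite_support {ρ : ℝ} (hρ : 0 < ρ ∧ ρ < 1) {N : ℕ} (hN : 1 < N) {μ : Measure ℝ}
    [NeZero μ] (hμ : IsSelfSimilar ρ N μ) : μ.support.Infinite := by
  obtain ⟨x, hx, hx0⟩ : ∃ x ∈ μ.support, x ≠ 0 := by
    obtain ⟨x, hx⟩ := Measure.nonempty_support (NeZero.ne μ)
    by_cases h : x = 0
    · exact ⟨1, by simpa [h] using mul_add_mem_support hμ hx hN, one_ne_zero⟩
    · exact ⟨x, hx, h⟩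
  refine Set.infinite_of_injective_forall_mem (f := fun n : ℕ => ρ ^ n * x) ?_ fun n => ?_
  · exact (mul_left_injective₀ hx0).comp (pow_right_injective₀ hρ.1 hρ.2.ne)
  · induction n with
    | zero => simpa using hx
    | succ n ih =>
      simpa [pow_succ', mul_assoc] using mul_add_mem_support hμ ih (zero_lt_one.trans hN)

theorem infinite_of_expTotal {μ : Measure ℝ} [IsFiniteMeasure μ] (hsupp : μ.support.Infinite)
    {Λ : Set ℝ} (hΛ : ExpTotal μ Λ) : Λ.Infinite := by
  intro hfin
  have := hfin.fintype
  obtain ⟨t, htS, htc⟩ := hsupp.exists_subset_card_eq (Fintype.card Λ + 1)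
  obtain ⟨U, hU, hdisj⟩ := t.finite_toSet.t2_separation
  have hUm : ∀ x, MeasurableSet (U x) := fun x => (hU x).2.measurableSet
  let e : Λ → ℝ → ℂ := fun l x =>
    (starRingEnd ℂ) (Complex.exp (-2 * Real.pi * Complex.I * (l : ℝ) * x))
  have he : ∀ l, Integrable (e l) μ := fun l =>
    (integrable_exp_mul μ l).congr'
      (Complex.continuous_conj.comp_aestronglyMeasurable (integrable_exp_mul μ l).1)
      (Filter.Eventually.of_forall fun x => (RCLike.norm_conj _).symm)
  let T : (t → ℂ) →ₗ[ℂ] (Λ → ℂ) :=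
    { toFun := fun c l => ∑ i, c i * ∫ x in U i, e l x ∂μ
      map_add' := fun c d => by ext l; simp [add_mul, Finset.sum_add_distrib]
      map_smul' := fun a c => by ext l; simp [mul_assoc, Finset.mul_sum] }
  obtain ⟨c, hcT, hc0⟩ := (Submodule.ne_bot_iff _).1
    (T.ker_ne_bot_of_finrank_lt (by simp [htc]))
  let g : ℝ → ℂ := fun x => ∑ i : t, (U i).indicator (fun _ => c i) x
  have hg : MemLp g 2 μ := memLp_finsetSum _ fun i _ =>
    memLp_indicator_const 2 (hUm i) (c i) (Or.inr (measure_ne_top μ _))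
  have hzero := hΛ hg.toLp fun l hl => by
    have hint : ∀ i : t, ∫ x, (U i).indicator (fun _ => c i) x * e ⟨l, hl⟩ x ∂μ =
        c i * ∫ x in U i, e ⟨l, hl⟩ x ∂μ := by
      intro i
      rw [← integral_const_mul, ← integral_indicator (hUm i)]
      congr 1 with x
      by_cases hx : x ∈ U i <;> simp [hx]
    calc _ = ∫ x, ∑ i : t, (U i).indicator (fun _ => c i) x * e ⟨l, hl⟩ x ∂μ := by
          refine integral_congr_ae ?_
          filter_upwards [hg.coeFn_toLp] with x hx
          rw [hx, ← Finset.sum_mul]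
      _ = T c ⟨l, hl⟩ := by
          rw [integral_finsetSum]
          · exact Finset.sum_congr rfl fun i _ => hint i
          · intro i _
            refine (((he ⟨l, hl⟩).const_mul (c i)).indicator (hUm i)).congr
              (Filter.Eventually.of_forall fun x => ?_)
            by_cases hx : x ∈ U i <;> simp [hx]
      _ = 0 := by rw [LinearMap.mem_ker.1 hcT]; rfl
  have hae : ∀ᵐ x ∂μ, g x = 0 := by
    filter_upwards [hg.coeFn_toLp, Lp.coeFn_zero ℂ 2 μ] with x h1 h2
    rw [← h1, hzero, h2, Pi.zero_apply]
  refine hc0 (funext fun i => ?_)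
  by_contra hci
  have hpos : 0 < μ (U i) := (Measure.mem_support_iff_forall _).1 (htS i.2) _
    ((hU i).2.mem_nhds (hU i).1)
  refine hpos.ne' (measure_mono_null (fun x hx => ?_) (ae_iff.1 hae))
  have : g x = c i := by
    refine (Finset.sum_eq_single i (fun j _ hji => ?_) (by simp)).trans (by simp [hx])
    have hd := hdisj j.2 i.2 fun h => hji (Subtype.ext h)
    exact Set.indicator_of_notMem (fun hj => Set.disjoint_left.1 hd hj hx) _
  simpa [this] using hci

theorem stmt_12 (ρ : ℝ) (hρ : 0 < ρ ∧ ρ < 1) (hirr : Irrational ρ)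
    (hnroot : ¬ ∃ (u : ℚ) (r : ℕ), 0 < u ∧ u < 1 ∧ 1 ≤ r ∧ ρ ^ r = (u : ℝ))
    (N : ℕ) (hN : 1 < N)
    (μ : Measure ℝ) [IsProbabilityMeasure μ] (hμ : IsSelfSimilar ρ N μ) :
    ¬ IsSpectral μ := by
  rintro ⟨Λ, -, hΛ, htot⟩
  have hN0 : 0 < N := zero_lt_one.trans hN
  have hx : ∀ m : ℕ, 0 < m → ∀ q : ℚ, ρ⁻¹ ^ m ≠ q := by
    intro m hm q hq
    have hρq : ρ ^ m = (q⁻¹ : ℚ) := by rw [Rat.cast_inv, ← hq, inv_pow, inv_inv]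
    have h0 : ((0 : ℚ) : ℝ) < (q⁻¹ : ℚ) := hρq ▸ (by simpa using pow_pos hρ.1 m)
    have h1 : ((q⁻¹ : ℚ) : ℝ) < (1 : ℚ) :=
      hρq ▸ (by simpa using pow_lt_one₀ hρ.1.le hρ.2 hm.ne')
    exact hnroot ⟨q⁻¹, m, Rat.cast_lt.1 h0, Rat.cast_lt.1 h1, hm, hρq⟩
  have hinj : Function.Injective fun l : ℝ => (N : ℝ) * l :=
    mul_right_injective₀ (by positivity)
  refine (infinite_of_expTotal (infinite_support hρ hN hμ) htot).image hinj.injOn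
    (finite_of_pairwise_sub_eq_mul_pow hx hN0.ne' ?_)
  rintro _ ⟨l, hl, rfl⟩ _ ⟨l', hl', rfl⟩ hne
  have hzero : FT μ (l - l') = 0 := by
    rw [hΛ l hl l' hl', if_neg fun h => hne (by rw [h])]
  obtain ⟨k, a, ha, e⟩ := exists_of_FT_eq_zero hρ hN0 hμ hzero
  exact ⟨k, a, ha, by rw [← e, mul_sub]⟩
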